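/- arXiv:2312.03397 — 5 statements merged into one kernel-verified Lean document; each statement's English description precedes it below -/
import Mathlib

section
/- Fix a temperature τ > 0, a data density p with p(x) > 0 for all x and p·log p integrable, and a constant c ∈ ℝ, and set E^p(x) = −τ·log p(x) + c. Then for every density π such that π·log π and π·log p are integrable, Φ(E^p, π) = τ·H(p) − τ·KL(π‖p); in particular this value does not depend on c, and since KL(π‖p) ≥ 0 it follows that Φ(E^p, π) ≤ Φ(E^p, p) = τ·H(p). -/
open MeasureTheory

/-- A density on `ℝ^d`: measurable, a.e. nonnegative, integrating to one
(w.r.t. Lebesgue measure). -/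
def IsDensity {d : ℕ} (ρ : (Fin d → ℝ) → ℝ) : Prop :=
  Measurable ρ ∧ (∀ᵐ x, 0 ≤ ρ x) ∧ Integrable ρ ∧ (∫ x, ρ x) = 1

/-- Differential entropy `H(ρ) = −∫ ρ log ρ` (with `0·log 0 = 0`). -/
noncomputable def H {d : ℕ} (ρ : (Fin d → ℝ) → ℝ) : ℝ :=
  -∫ x, ρ x * Real.log (ρ x)

/-- KL divergence `KL(ρ‖σ) = ∫ ρ log(ρ/σ)` (with `0·log 0 = 0`). -/
noncomputable def KL {d : ℕ} (ρ σ : (Fin d → ℝ) → ℝ) : ℝ :=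
  ∫ x, ρ x * Real.log (ρ x / σ x)

/-- The GCD objective `Φ(E, π) = ∫ p E − ∫ π E + τ H(π)`. -/
noncomputable def Phi {d : ℕ} (τ : ℝ) (p E π : (Fin d → ℝ) → ℝ) : ℝ :=
  (∫ x, p x * E x) - (∫ x, π x * E x) + τ * H π

/-- at the optimal energy `E^p = −τ log p + c`, the GCD objective satisfies
`Φ(E^p, π) = τ H(p) − τ KL(π‖p)` (independently of `c`), hence
`Φ(E^p, π) ≤ Φ(E^p, p) = τ H(p)`. -/
theorem phi_at_optimal_energy {d : ℕ} (τ : ℝ) (hτ : 0 < τ)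
    (p : (Fin d → ℝ) → ℝ) (hp : IsDensity p) (hppos : ∀ x, 0 < p x)
    (hplogp : Integrable (fun x => p x * Real.log (p x)))
    (c : ℝ) (Ep : (Fin d → ℝ) → ℝ) (hEp : Ep = fun x => -τ * Real.log (p x) + c)
    (π : (Fin d → ℝ) → ℝ) (hπ : IsDensity π)
    (hπlogπ : Integrable (fun x => π x * Real.log (π x)))
    (hπlogp : Integrable (fun x => π x * Real.log (p x))) :
    Phi τ p Ep π = τ * H p - τ * KL π p ∧
    Phi τ p Ep π ≤ Phi τ p Ep p ∧
    Phi τ p Ep p = τ * H p := by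
  have key : ∀ q : (Fin d → ℝ) → ℝ, IsDensity q →
      Integrable (fun x => q x * Real.log (p x)) →
      ∫ x, q x * Ep x = -τ * (∫ x, q x * Real.log (p x)) + c := by
    intro q hq hqi
    have h1 : (fun x => q x * Ep x)
        = fun x => -τ * (q x * Real.log (p x)) + c * q x := by
      funext x
      rw [hEp]
      ring
    rw [h1, integral_add (hqi.const_mul _) (hq.2.2.1.const_mul _),
      integral_const_mul, integral_const_mul, hq.2.2.2, mul_one]
  have hpt : ∀ x, π x * Real.log (π x / p x)
      = π x * Real.log (π x) - π x * Real.log (p x) := by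
    intro x
    by_cases h : π x = 0
    · simp [h]
    · rw [Real.log_div h (hppos x).ne']
      ring
  have hKL : KL π p = (∫ x, π x * Real.log (π x)) - ∫ x, π x * Real.log (p x) := by
    unfold KL
    simp_rw [hpt]
    exact integral_sub hπlogπ hπlogp
  have hKL0 : 0 ≤ KL π p := by
    have hle : ∫ x, (π x - p x) ≤ ∫ x, (π x * Real.log (π x) - π x * Real.log (p x)) := by
      apply integral_mono_ae (hπ.2.2.1.sub hp.2.2.1) (hπlogπ.sub hπlogp)
      filter_upwards [hπ.2.1] with x hx
      show π x - p x ≤ π x * Real.log (π x) - π x * Real.log (p x)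
      have hpx := hppos x
      rcases hx.eq_or_lt with h | h
      · rw [← h]
        simp [hpx.le]
      · have h2 := Real.log_le_sub_one_of_pos (div_pos hpx h)
        rw [Real.log_div hpx.ne' h.ne'] at h2
        have h3 := mul_le_mul_of_nonneg_left h2 hx
        have h4 : π x * (p x / π x - 1) = p x - π x := by
          field_simp
        rw [h4] at h3
        linarith
    rw [integral_sub hπ.2.2.1 hp.2.2.1, hπ.2.2.2, hp.2.2.2,
      integral_sub hπlogπ hπlogp] at hle
    rw [hKL]
    linarith
  have e1 : Phi τ p Ep π = τ * H p - τ * KL π p := by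
    rw [hKL]
    unfold Phi H
    rw [key p hp hplogp, key π hπ hπlogp]
    ring
  have e2 : Phi τ p Ep p = τ * H p := by
    unfold Phi
    ring
  refine ⟨e1, ?_, e2⟩
  rw [e1, e2]
  have := mul_nonneg hτ.le hKL0
  linarith
end

section
/- Fix a temperature τ > 0, a data density p with p(x) > 0 for all x and p·log p integrable, a constant c ∈ ℝ, and set E^p(x) = −τ·log p(x) + c. Then (E^p, p) is a saddle point of the GCD objective Φ: (i) for every density π with π·log π and π·log p integrable, Φ(E^p, π) ≤ Φ(E^p, p); and (ii) for every measurable E : ℝ^d → ℝ with p·E integrable, Φ(E, p) = Φ(E^p, p) = τ·H(p). -/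
open MeasureTheory

/-- `(E^p, p)` with `E^p = −τ log p + c` is a saddle point of the GCD
objective `Φ`: (i) `Φ(E^p, π) ≤ Φ(E^p, p)` for all admissible densities `π`, and
(ii) `Φ(E, p) = Φ(E^p, p) = τ H(p)` for all admissible energies `E`. -/
theorem saddle_point_of_gcd_energy {d : ℕ} (τ : ℝ) (hτ : 0 < τ)
    (p : (Fin d → ℝ) → ℝ) (hp : IsDensity p) (hppos : ∀ x, 0 < p x)
    (hplogp : Integrable (fun x => p x * Real.log (p x)))
    (c : ℝ) (Ep : (Fin d → ℝ) → ℝ) (hEp : Ep = fun x => -τ * Real.log (p x) + c) :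
    (∀ π : (Fin d → ℝ) → ℝ, IsDensity π →
        Integrable (fun x => π x * Real.log (π x)) →
        Integrable (fun x => π x * Real.log (p x)) →
        Phi τ p Ep π ≤ Phi τ p Ep p) ∧
    (∀ E : (Fin d → ℝ) → ℝ, Measurable E → Integrable (fun x => p x * E x) →
        Phi τ p E p = Phi τ p Ep p ∧ Phi τ p Ep p = τ * H p) := by
  have key : ∀ E : (Fin d → ℝ) → ℝ, Phi τ p E p = τ * H p := by
    intro E
    simp [Phi]
  refine ⟨?_, fun E _ _ => ⟨by rw [key, key], key Ep⟩⟩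
  intro π hπ h1 h2
  rw [key]
  obtain ⟨-, -, hpi, hp1⟩ := hp
  obtain ⟨-, hπ0, hπi, hπ1⟩ := hπ
  have e : ∀ ρ : (Fin d → ℝ) → ℝ, Integrable ρ → (∫ x, ρ x) = 1 →
      Integrable (fun x => ρ x * Real.log (p x)) →
      (∫ x, ρ x * Ep x) = -τ * (∫ x, ρ x * Real.log (p x)) + c := by
    intro ρ hi h1 hl
    have : (fun x => ρ x * Ep x) =
        fun x => -τ * (ρ x * Real.log (p x)) + c * ρ x := by
      funext x
      rw [hEp]
      ring
    rw [this, integral_add (hl.const_mul _) (hi.const_mul _), integral_const_mul,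
      integral_const_mul, h1, mul_one]
  have hle : (∫ x, (π x * Real.log (p x) - π x * Real.log (π x))) ≤ ∫ x, (p x - π x) := by
    apply integral_mono_ae (h2.sub h1) (hpi.sub hπi)
    filter_upwards [hπ0] with x hx
    rcases hx.eq_or_lt with h | h
    · simp [← h, (hppos x).le]
    · have hl := Real.log_le_sub_one_of_pos (div_pos (hppos x) h)
      rw [Real.log_div (hppos x).ne' h.ne'] at hl
      have hm := mul_le_mul_of_nonneg_left hl h.le
      have : π x * (p x / π x - 1) = p x - π x := by
        field_simp
      change π x * Real.log (p x) - π x * Real.log (π x) ≤ p x - π x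
      linarith
  rw [integral_sub h2 h1, integral_sub hpi hπi, hp1, hπ1] at hle
  unfold Phi H
  rw [e p hpi hp1 hplogp, e π hπi hπ1 h2]
  nlinarith [mul_le_mul_of_nonneg_left hle hτ.le]
end

section
/- Fix a temperature τ > 0, a data density p with p(x) > 0 for all x and p·log p integrable, and set E^p(x) = −τ·log p(x) + c for a constant c ∈ ℝ. Let π be a density with π·log π and π·log p integrable, and let S be a set of measurable functions E : ℝ^d → ℝ, each with p·E and π·E integrable, such that E^p ∈ S. Then, with D^S(p‖π) = sup_{E∈S} |∫ p(x)E(x) dx − ∫ π(x)E(x) dx|, one has D^S(p‖π) − τ·H(π) ≥ τ·KL(π‖p) − τ·H(p) ≥ −τ·H(p). -/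
open MeasureTheory

/-- with `E^p = −τ log p + c ∈ S`, the entropy-regularized IPM objective is
bounded below: `D^S(p‖π) − τ H(π) ≥ τ KL(π‖p) − τ H(p) ≥ −τ H(p)`. -/
theorem ipm_entropy_lower_bound {d : ℕ} (τ : ℝ) (hτ : 0 < τ)
    (p : (Fin d → ℝ) → ℝ) (hp : IsDensity p) (hppos : ∀ x, 0 < p x)
    (hplogp : Integrable (fun x => p x * Real.log (p x)))
    (c : ℝ) (Ep : (Fin d → ℝ) → ℝ) (hEp : Ep = fun x => -τ * Real.log (p x) + c)
    (π : (Fin d → ℝ) → ℝ) (hπ : IsDensity π)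
    (hπlogπ : Integrable (fun x => π x * Real.log (π x)))
    (hπlogp : Integrable (fun x => π x * Real.log (p x)))
    (S : Set ((Fin d → ℝ) → ℝ)) (hSmeas : ∀ E ∈ S, Measurable E)
    (hSint : ∀ E ∈ S, Integrable (fun x => p x * E x) ∧ Integrable (fun x => π x * E x))
    (hEpS : Ep ∈ S) :
    ((τ * KL π p - τ * H p : ℝ) : EReal)
        ≤ (⨆ E ∈ S, ((|(∫ x, p x * E x) - ∫ x, π x * E x| : ℝ) : EReal))
            - ((τ * H π : ℝ) : EReal) ∧
    -τ * H p ≤ τ * KL π p - τ * H p := by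
  obtain ⟨-, -, hpi, hp1⟩ := hp
  obtain ⟨-, hπ0, hπi, hπ1⟩ := hπ
  have hpt : ∀ x, π x * Real.log (π x / p x)
      = π x * Real.log (π x) - π x * Real.log (p x) := by
    intro x
    by_cases h : π x = 0
    · simp [h]
    · rw [Real.log_div h (hppos x).ne']; ring
  have hKL : KL π p = (∫ x, π x * Real.log (π x)) - ∫ x, π x * Real.log (p x) := by
    unfold KL
    simp_rw [hpt]
    exact integral_sub hπlogπ hπlogp
  have hKL0 : 0 ≤ KL π p := by
    have h1 : (∫ x, (π x - p x)) ≤ ∫ x, π x * Real.log (π x / p x) := by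
      refine integral_mono_ae (hπi.sub hpi) ?_ ?_
      · simp_rw [hpt]
        exact hπlogπ.sub hπlogp
      · filter_upwards [hπ0] with x hx
        have hpx := hppos x
        rcases hx.eq_or_lt with h | h
        · simp [← h, hpx.le]
        · have h2 := Real.one_sub_inv_le_log_of_pos (div_pos h hpx)
          have h3 := mul_le_mul_of_nonneg_left h2 hx
          have h4 : π x * (1 - (π x / p x)⁻¹) = π x - p x := by
            field_simp
          linarith
    rw [integral_sub hπi hpi, hp1, hπ1] at h1
    unfold KL
    linarith
  have hint : ∀ q : (Fin d → ℝ) → ℝ, Integrable q → (∫ x, q x) = 1 →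
      Integrable (fun x => q x * Real.log (p x)) →
      (∫ x, q x * Ep x) = -τ * (∫ x, q x * Real.log (p x)) + c := by
    intro q hq hq1 hql
    have : ∀ x, q x * Ep x = -τ * (q x * Real.log (p x)) + q x * c := by
      intro x; rw [hEp]; ring
    simp_rw [this]
    rw [integral_add (hql.const_mul _) (hq.mul_const _), integral_const_mul,
      integral_mul_const, hq1, one_mul]
  refine ⟨?_, by nlinarith [mul_nonneg hτ.le hKL0]⟩
  have hle : (τ * KL π p - τ * H p) ≤
      |(∫ x, p x * Ep x) - ∫ x, π x * Ep x| - τ * H π := by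
    have := neg_abs_le ((∫ x, p x * Ep x) - ∫ x, π x * Ep x)
    rw [hint p hpi hp1 hplogp, hint π hπi hπ1 hπlogp] at this ⊢
    rw [hKL]
    unfold H
    linarith
  refine (EReal.coe_le_coe_iff.2 hle).trans ?_
  rw [EReal.coe_sub]
  exact EReal.sub_le_sub (le_iSup₂_of_le Ep hEpS le_rfl) le_rfl
end

section
/- Fix a temperature τ > 0 and a data density p with p(x) > 0 for all x and p·log p integrable. Let Π be a set of densities containing p, each π ∈ Π having π·log π and π·log p integrable, and let S be a set of measurable functions E : ℝ^d → ℝ, each with p·E integrable and π·E integrable for every π ∈ Π, such that E^p(x) = −τ·log p(x) + c belongs to S for some constant c ∈ ℝ. Then the entropy-regularized IPM minimization attains its optimum at π = p: inf_{π∈Π} (D^S(p‖π) − τ·H(π)) = −τ·H(p), where D^S(p‖π) = sup_{E∈S} |∫ p(x)E(x) dx − ∫ π(x)E(x) dx|, and the infimum is attained at π = p (at which D^S(p‖p) = 0). -/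
open MeasureTheory

theorem gibbs_aux {d : ℕ} (p π : (Fin d → ℝ) → ℝ) (hp : IsDensity p) (hppos : ∀ x, 0 < p x)
    (hπ : IsDensity π) (h1 : Integrable (fun x => π x * Real.log (π x)))
    (h2 : Integrable (fun x => π x * Real.log (p x))) :
    (∫ x, π x * Real.log (p x)) ≤ ∫ x, π x * Real.log (π x) := by
  obtain ⟨-, -, hpi, hp1⟩ := hp
  obtain ⟨-, h0, hqi, hq1⟩ := hπ
  have key : (∫ x, (π x * Real.log (p x) - π x * Real.log (π x))) ≤ ∫ x, (p x - π x) := by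
    apply integral_mono_ae (h2.sub h1) (hpi.sub hqi)
    filter_upwards [h0] with x hx
    show π x * Real.log (p x) - π x * Real.log (π x) ≤ p x - π x
    rcases hx.eq_or_lt with h | h
    · rw [← h]; simpa using (hppos x).le
    · have hl := Real.log_le_sub_one_of_pos (div_pos (hppos x) h)
      rw [Real.log_div (hppos x).ne' h.ne'] at hl
      have := mul_le_mul_of_nonneg_left hl h.le
      have e : π x * (p x / π x - 1) = p x - π x := by field_simp
      linarith
  rw [integral_sub h2 h1, integral_sub hpi hqi, hp1, hq1] at key
  linarith

theorem energy_aux {d : ℕ} (τ c : ℝ) (p π : (Fin d → ℝ) → ℝ) (hπ : IsDensity π)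
    (h2 : Integrable (fun x => π x * Real.log (p x))) :
    (∫ x, π x * (-τ * Real.log (p x) + c)) = -τ * (∫ x, π x * Real.log (p x)) + c := by
  obtain ⟨-, -, hqi, hq1⟩ := hπ
  have e : (fun x => π x * (-τ * Real.log (p x) + c))
      = fun x => -τ * (π x * Real.log (p x)) + c * π x := by
    funext x; ring
  rw [e, integral_add (h2.const_mul _) (hqi.const_mul _), integral_const_mul,
    integral_const_mul, hq1, mul_one]

/-- the entropy-regularized IPM minimization
`inf_{π∈Π} (D^S(p‖π) − τ H(π))` has value `−τ H(p)`, attained at `π = p`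
(where `D^S(p‖p) = 0`). -/
theorem ipm_entropy_min_attained_at_data {d : ℕ} (τ : ℝ) (hτ : 0 < τ)
    (p : (Fin d → ℝ) → ℝ) (hp : IsDensity p) (hppos : ∀ x, 0 < p x)
    (hplogp : Integrable (fun x => p x * Real.log (p x)))
    (Pi : Set ((Fin d → ℝ) → ℝ)) (hpPi : p ∈ Pi)
    (hPi : ∀ π ∈ Pi, IsDensity π ∧ Integrable (fun x => π x * Real.log (π x)) ∧
        Integrable (fun x => π x * Real.log (p x)))
    (S : Set ((Fin d → ℝ) → ℝ)) (hSmeas : ∀ E ∈ S, Measurable E)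
    (hSint : ∀ E ∈ S, Integrable (fun x => p x * E x) ∧
        ∀ π ∈ Pi, Integrable (fun x => π x * E x))
    (c : ℝ) (hEpS : (fun x => -τ * Real.log (p x) + c) ∈ S) :
    (⨅ π ∈ Pi, ((⨆ E ∈ S, ((|(∫ x, p x * E x) - ∫ x, π x * E x| : ℝ) : EReal))
          - ((τ * H π : ℝ) : EReal)))
        = ((-τ * H p : ℝ) : EReal) ∧
    (⨆ E ∈ S, ((|(∫ x, p x * E x) - ∫ x, p x * E x| : ℝ) : EReal)) = (0 : EReal) ∧
    (⨆ E ∈ S, ((|(∫ x, p x * E x) - ∫ x, p x * E x| : ℝ) : EReal))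
        - ((τ * H p : ℝ) : EReal) = ((-τ * H p : ℝ) : EReal) := by
  have hD : (⨆ E ∈ S, ((|(∫ x, p x * E x) - ∫ x, p x * E x| : ℝ) : EReal)) = (0 : EReal) := by
    simp only [sub_self, abs_zero, EReal.coe_zero]
    exact biSup_const ⟨_, hEpS⟩
  have hV : (⨆ E ∈ S, ((|(∫ x, p x * E x) - ∫ x, p x * E x| : ℝ) : EReal))
        - ((τ * H p : ℝ) : EReal) = ((-τ * H p : ℝ) : EReal) := by
    rw [hD, zero_sub, ← EReal.coe_neg, neg_mul]
  refine ⟨le_antisymm ?_ ?_, hD, hV⟩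
  · exact (iInf₂_le p hpPi).trans hV.le
  · refine le_iInf₂ fun π hπ => ?_
    obtain ⟨hd, h1, h2⟩ := hPi π hπ
    have hg := gibbs_aux p π hp hppos hd h1 h2
    have hle := le_iSup₂ (f := fun E (_ : E ∈ S) =>
      ((|(∫ x, p x * E x) - ∫ x, π x * E x| : ℝ) : EReal)) _ hEpS
    refine le_trans ?_ (EReal.sub_le_sub hle le_rfl)
    rw [← EReal.coe_sub, EReal.coe_le_coe_iff]
    rw [energy_aux τ c p p hp hplogp, energy_aux τ c p π hd h2]
    have ha := neg_abs_le ((-τ * (∫ x, p x * Real.log (p x)) + c)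
      - (-τ * (∫ x, π x * Real.log (p x)) + c))
    have hm := mul_le_mul_of_nonneg_left hg hτ.le
    unfold H
    linarith
end

section
/- Fix a temperature τ > 0 and a data density p with p(x) > 0 for all x and p·log p integrable. Let Π be a set of densities containing p, each π ∈ Π having π·log π and π·log p integrable, and let S be a set of measurable functions E : ℝ^d → ℝ, each with p·E integrable and π·E integrable for every π ∈ Π, such that E^p(x) = −τ·log p(x) + c belongs to S for some constant c ∈ ℝ. Then the GCD learning problem in energy form has optimal value inf_{E∈S} sup_{π∈Π} Φ(E, π) = τ·H(p); the infimum is attained at E = E^p, for which sup_{π∈Π} Φ(E^p, π) = Φ(E^p, p) = τ·H(p). -/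
open MeasureTheory

/-- GCD learning in energy form has optimal value
`inf_{E∈S} sup_{π∈Π} Φ(E, π) = τ H(p)`, attained at `E = E^p = −τ log p + c`,
for which `sup_{π∈Π} Φ(E^p, π) = Φ(E^p, p) = τ H(p)`. -/
theorem gcd_energy_minimax_value {d : ℕ} (τ : ℝ) (hτ : 0 < τ)
    (p : (Fin d → ℝ) → ℝ) (hp : IsDensity p) (hppos : ∀ x, 0 < p x)
    (hplogp : Integrable (fun x => p x * Real.log (p x)))
    (Pi : Set ((Fin d → ℝ) → ℝ)) (hpPi : p ∈ Pi)
    (hPi : ∀ π ∈ Pi, IsDensity π ∧ Integrable (fun x => π x * Real.log (π x)) ∧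
        Integrable (fun x => π x * Real.log (p x)))
    (S : Set ((Fin d → ℝ) → ℝ)) (hSmeas : ∀ E ∈ S, Measurable E)
    (hSint : ∀ E ∈ S, Integrable (fun x => p x * E x) ∧
        ∀ π ∈ Pi, Integrable (fun x => π x * E x))
    (c : ℝ) (Ep : (Fin d → ℝ) → ℝ) (hEp : Ep = fun x => -τ * Real.log (p x) + c)
    (hEpS : Ep ∈ S) :
    (⨅ E ∈ S, ⨆ π ∈ Pi, ((Phi τ p E π : ℝ) : EReal)) = ((τ * H p : ℝ) : EReal) ∧
    (⨆ π ∈ Pi, ((Phi τ p Ep π : ℝ) : EReal)) = ((Phi τ p Ep p : ℝ) : EReal) ∧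
    Phi τ p Ep p = τ * H p := by
  have hself : ∀ E, Phi τ p E p = τ * H p := by
    intro E
    simp [Phi]
  have hgibbs : ∀ π ∈ Pi, Phi τ p Ep π ≤ τ * H p := by
    intro π hπ
    obtain ⟨⟨-, hπ0, hπi, hπ1⟩, hπl, hπp⟩ := hPi π hπ
    obtain ⟨-, -, hpi, hp1⟩ := hp
    have hE : ∀ ρ : (Fin d → ℝ) → ℝ, Integrable ρ → (∫ x, ρ x) = 1 →
        Integrable (fun x => ρ x * Real.log (p x)) →
        (∫ x, ρ x * Ep x) = -τ * (∫ x, ρ x * Real.log (p x)) + c := by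
      intro ρ h1 h2 h3
      have : (fun x => ρ x * Ep x) =
          fun x => -τ * (ρ x * Real.log (p x)) + c * ρ x := by
        funext x
        rw [hEp]
        ring
      rw [this, integral_add (h3.const_mul _) (h1.const_mul _),
        integral_const_mul, integral_const_mul, h2, mul_one]
    have key : (∫ x, (π x * Real.log (p x) - π x * Real.log (π x))) ≤
        ∫ x, (p x - π x) := by
      apply integral_mono_ae (hπp.sub hπl) (hpi.sub hπi)
      filter_upwards [hπ0] with x hx
      rcases hx.eq_or_lt with h | h
      · simp [← h, (hppos x).le]
      · have h1 := Real.log_le_sub_one_of_pos (div_pos (hppos x) h)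
        rw [Real.log_div (hppos x).ne' h.ne'] at h1
        have h2 := mul_le_mul_of_nonneg_left h1 h.le
        have h3 : π x * (p x / π x - 1) = p x - π x := by
          field_simp
        show π x * Real.log (p x) - π x * Real.log (π x) ≤ p x - π x
        linarith
    rw [integral_sub hπp hπl, integral_sub hpi hπi, hp1, hπ1] at key
    have h4 := mul_le_mul_of_nonneg_left key hτ.le
    unfold Phi H
    rw [hE p hpi hp1 hplogp, hE π hπi hπ1 hπp]
    linarith
  have hsup : (⨆ π ∈ Pi, ((Phi τ p Ep π : ℝ) : EReal)) = ((Phi τ p Ep p : ℝ) : EReal) := by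
    apply le_antisymm
    · refine iSup₂_le fun π hπ => ?_
      rw [hself]
      exact_mod_cast hgibbs π hπ
    · exact le_iSup₂ (f := fun π (_ : π ∈ Pi) => ((Phi τ p Ep π : ℝ) : EReal)) p hpPi
  refine ⟨le_antisymm ?_ ?_, hsup, hself Ep⟩
  · refine (iInf₂_le Ep hEpS).trans ?_
    rw [hsup, hself]
  · refine le_iInf₂ fun E hE => ?_
    rw [← hself E]
    exact le_iSup₂ (f := fun π (_ : π ∈ Pi) => ((Phi τ p E π : ℝ) : EReal)) p hpPi
end
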